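/- Let ρ_ABC be an invertible density operator on H_A⊗H_B⊗H_C with I_{ρ_ABC}(A:C|B) = 0, and let ρ_AB, ρ_BC, ρ_B be its marginals. Then Tr_A(ρ_AB) = Tr_C(ρ_BC) and the operator Θ_ABC := ρ_BC^{1/2} ρ_B^{−1/2} ρ_AB^{1/2} (each factor extended to H_A⊗H_B⊗H_C by tensoring with identities) is Hermitian; in particular Θ_ABC is normal. -/

import Mathlib

open scoped Matrix ComplexOrder

variable {A B C : Type*}

/-- Functional calculus for Hermitian matrices: apply `f : ℝ → ℝ` to the eigenvalues. -/
noncomputable def matFun {n : Type*} [Fintype n] [DecidableEq n]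
    (f : ℝ → ℝ) (ρ : Matrix n n ℂ) : Matrix n n ℂ :=
  if h : ρ.IsHermitian then
    (h.eigenvectorUnitary : Matrix n n ℂ) *
      Matrix.diagonal (fun i => (f (h.eigenvalues i) : ℂ)) *
        (star (h.eigenvectorUnitary : Matrix n n ℂ))
  else 0

/-- Matrix logarithm via functional calculus. -/
noncomputable def matLog {n : Type*} [Fintype n] [DecidableEq n] (ρ : Matrix n n ℂ) :
    Matrix n n ℂ := matFun Real.log ρ

/-- Matrix square root via functional calculus. -/
noncomputable def matSqrt {n : Type*} [Fintype n] [DecidableEq n] (ρ : Matrix n n ℂ) :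
    Matrix n n ℂ := matFun Real.sqrt ρ

/-- Matrix inverse square root via functional calculus. -/
noncomputable def matInvSqrt {n : Type*} [Fintype n] [DecidableEq n] (ρ : Matrix n n ℂ) :
    Matrix n n ℂ := matFun (fun x => (Real.sqrt x)⁻¹) ρ

/-- A density operator: positive semidefinite with trace one. -/
def IsDensity {n : Type*} [Fintype n] (ρ : Matrix n n ℂ) : Prop :=
  ρ.PosSemidef ∧ ρ.trace = 1

/-- The von Neumann entropy `S(ρ) = -Tr(ρ log ρ)`, computed via eigenvalues. -/
noncomputable def vnEntropy {n : Type*} [Fintype n] [DecidableEq n] (ρ : Matrix n n ℂ) : ℝ :=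
  if h : ρ.IsHermitian then -∑ i, h.eigenvalues i * Real.log (h.eigenvalues i) else 0

/-- The quantum relative entropy `S(ρ‖σ) = Tr[ρ (log ρ - log σ)]`. -/
noncomputable def relEntropy {n : Type*} [Fintype n] [DecidableEq n]
    (ρ σ : Matrix n n ℂ) : ℝ := ((ρ * (matLog ρ - matLog σ)).trace).re

section Tripartite

variable [Fintype A] [Fintype B] [Fintype C]

/-- Partial trace over the third factor. -/
noncomputable def ptC (ρ : Matrix (A × B × C) (A × B × C) ℂ) : Matrix (A × B) (A × B) ℂ :=
  fun x y => ∑ c : C, ρ (x.1, x.2, c) (y.1, y.2, c)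

/-- Partial trace over the first factor. -/
noncomputable def ptA (ρ : Matrix (A × B × C) (A × B × C) ℂ) : Matrix (B × C) (B × C) ℂ :=
  fun x y => ∑ a : A, ρ (a, x) (a, y)

/-- Partial trace over the first and third factors. -/
noncomputable def ptAC (ρ : Matrix (A × B × C) (A × B × C) ℂ) : Matrix B B ℂ :=
  fun b b' => ∑ a : A, ∑ c : C, ρ (a, b, c) (a, b', c)

/-- Partial trace over the first and second factors. -/
noncomputable def ptAB (ρ : Matrix (A × B × C) (A × B × C) ℂ) : Matrix C C ℂ :=
  fun c c' => ∑ a : A, ∑ b : B, ρ (a, b, c) (a, b, c')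

/-- Partial trace over the second and third factors. -/
noncomputable def ptBC (ρ : Matrix (A × B × C) (A × B × C) ℂ) : Matrix A A ℂ :=
  fun a a' => ∑ b : B, ∑ c : C, ρ (a, b, c) (a', b, c)

/-- Partial trace of a bipartite state over its first factor. -/
noncomputable def bptFst {X Y : Type*} [Fintype X] [Fintype Y]
    (M : Matrix (X × Y) (X × Y) ℂ) : Matrix Y Y ℂ :=
  fun b b' => ∑ x : X, M (x, b) (x, b')

/-- Partial trace of a bipartite state over its second factor. -/
noncomputable def bptSnd {X Y : Type*} [Fintype X] [Fintype Y]
    (M : Matrix (X × Y) (X × Y) ℂ) : Matrix X X ℂ :=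
  fun a a' => ∑ y : Y, M (a, y) (a', y)

variable [DecidableEq A] [DecidableEq B] [DecidableEq C]

/-- Extend an operator on the first two factors to the tripartite space: `M ⊗ id_C`. -/
noncomputable def extAB (M : Matrix (A × B) (A × B) ℂ) :
    Matrix (A × B × C) (A × B × C) ℂ :=
  fun x y => M (x.1, x.2.1) (y.1, y.2.1) * (if x.2.2 = y.2.2 then 1 else 0)

/-- Extend an operator on the last two factors to the tripartite space: `id_A ⊗ M`. -/
noncomputable def extBC (M : Matrix (B × C) (B × C) ℂ) :
    Matrix (A × B × C) (A × B × C) ℂ :=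
  fun x y => (if x.1 = y.1 then 1 else 0) * M x.2 y.2

/-- Extend an operator on the middle factor to the tripartite space: `id_A ⊗ M ⊗ id_C`. -/
noncomputable def extB (M : Matrix B B ℂ) : Matrix (A × B × C) (A × B × C) ℂ :=
  fun x y => (if x.1 = y.1 then 1 else 0) * M x.2.1 y.2.1 * (if x.2.2 = y.2.2 then 1 else 0)

/-- Quantum conditional mutual information `I_ρ(A:C|B)`. -/
noncomputable def qcmi (ρ : Matrix (A × B × C) (A × B × C) ℂ) : ℝ :=
  vnEntropy (ptC ρ) + vnEntropy (ptA ρ) - vnEntropy (ptAC ρ) - vnEntropy ρ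

end Tripartite

set_option linter.unusedSectionVars false
set_option linter.unusedSimpArgs false

/-- Cauchy kernels determine all functions on a finite set of points. -/
lemma cauchy_indep (s : Finset ℝ) (e : ℝ → ℂ)
    (h : ∀ t : ℝ, 0 < t → ∑ a ∈ s, e a * ((a + t : ℝ) : ℂ)⁻¹ = 0)
    (hs : ∀ a ∈ s, 0 < a) : ∀ a ∈ s, e a = 0 := by
  classical
  let P : Polynomial ℂ := ∑ a ∈ s, Polynomial.C (e a) *
    ∏ b ∈ s.erase a, (Polynomial.C (b : ℂ) + Polynomial.X)
  have hP : P = 0 := by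
    apply Polynomial.eq_zero_of_infinite_isRoot
    have hinf : (((fun t : ℝ => (t : ℂ)) '' Set.Ioi (0 : ℝ))).Infinite :=
      (Set.Ioi_infinite (0 : ℝ)).image (fun x _ y _ hxy => Complex.ofReal_injective hxy)
    refine hinf.mono ?_
    rintro _ ⟨t, ht, rfl⟩
    have ht' : 0 < t := ht
    show Polynomial.eval (t : ℂ) P = 0
    simp only [P, Polynomial.eval_finsetSum, Polynomial.eval_mul, Polynomial.eval_C,
      Polynomial.eval_prod, Polynomial.eval_add, Polynomial.eval_X]
    have h0 := congrArg (fun z => z * ∏ b ∈ s, ((b : ℂ) + t)) (h t ht')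
    simp only [zero_mul, Finset.sum_mul] at h0
    rw [← h0]
    refine Finset.sum_congr rfl fun a ha => ?_
    have hne : ((a : ℂ) + t) ≠ 0 := by
      have := hs a ha
      have h1 : a + t ≠ 0 := by positivity
      exact_mod_cast h1
    rw [← Finset.mul_prod_erase s _ ha]
    push_cast
    field_simp
  intro a ha
  have h1 : Polynomial.eval (-(a : ℂ)) P = 0 := by rw [hP]; simp
  simp only [P, Polynomial.eval_finsetSum, Polynomial.eval_mul, Polynomial.eval_C,
      Polynomial.eval_prod, Polynomial.eval_add, Polynomial.eval_X] at h1
  rw [Finset.sum_eq_single a] at h1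
  · rcases mul_eq_zero.1 h1 with h2 | h2
    · exact h2
    · exfalso
      obtain ⟨b, hb, hb0⟩ := Finset.prod_eq_zero_iff.1 h2
      have : (b : ℂ) = a := by linear_combination hb0
      exact (Finset.mem_erase.1 hb).1 (Complex.ofReal_injective this)
  · intro b hb hba
    rw [mul_eq_zero]; right
    exact Finset.prod_eq_zero (Finset.mem_erase.2 ⟨hba.symm, ha⟩) (by ring)
  · intro h; exact absurd ha h

lemma cauchy_fun {k : Type*} [Fintype k] (a : k → ℝ) (ha : ∀ i, 0 < a i) (e : k → ℂ)
    (h : ∀ t : ℝ, 0 < t → ∑ i, e i * ((a i + t : ℝ) : ℂ)⁻¹ = 0) (f : ℝ → ℂ) :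
    ∑ i, e i * f (a i) = 0 := by
  classical
  have key : ∀ g : ℝ → ℂ, ∑ i, e i * g (a i) =
      ∑ x ∈ Finset.univ.image a, (∑ i with a i = x, e i) * g x := by
    intro g
    rw [← Finset.sum_fiberwise_of_maps_to (s := Finset.univ) (t := Finset.univ.image a) (g := a)
      (fun i _ => Finset.mem_image_of_mem a (Finset.mem_univ i))]
    refine Finset.sum_congr rfl fun x _ => ?_
    rw [Finset.sum_mul]
    refine Finset.sum_congr rfl fun i hi => ?_
    rw [(Finset.mem_filter.1 hi).2]
  rw [key]
  refine Finset.sum_eq_zero fun x hx => ?_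
  rw [cauchy_indep (Finset.univ.image a) (fun x => ∑ i with a i = x, e i) ?_ ?_ x hx, zero_mul]
  · intro t ht
    rw [← h t ht, key (fun x => ((x + t : ℝ) : ℂ)⁻¹)]
  · intro y hy
    obtain ⟨i, _, rfl⟩ := Finset.mem_image.1 hy
    exact ha i

/-- The gap identity. -/
lemma gap_identity {m n : Type*} [Fintype m] [Fintype n] (lam : n → ℝ) (mu : m → ℝ)
    (hl : ∀ i, 0 < lam i) (hm : ∀ j, 0 < mu j)
    (V : (m → ℂ) →ₗ[ℂ] (n → ℂ))
    (h1 : ∀ x y, ∑ i, star (V x i) * V y i = ∑ j, star (x j) * y j)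
    (h2 : ∀ x, ∑ i, (lam i : ℂ) * (star (V x i) * V x i) = ∑ j, (mu j : ℂ) * (star (x j) * x j))
    (ψ : m → ℂ) (t : ℝ) (ht : 0 < t) :
    ∑ i, Complex.normSq (V ψ i) * (lam i + t)⁻¹ - ∑ j, Complex.normSq (ψ j) * (mu j + t)⁻¹
      = ∑ i, (lam i + t) * Complex.normSq
        (V ψ i * ((lam i + t : ℝ) : ℂ)⁻¹ - V (fun j => ψ j * ((mu j + t : ℝ) : ℂ)⁻¹) i) := by
  set y : m → ℂ := fun j => ψ j * ((mu j + t : ℝ) : ℂ)⁻¹ with hy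
  have hl' : ∀ i, ((lam i : ℂ) + t) ≠ 0 := fun i => by
    have := hl i
    have h1 : lam i + t ≠ 0 := by positivity
    exact_mod_cast h1
  have hm' : ∀ i, ((mu i : ℂ) + t) ≠ 0 := fun i => by
    have := hm i
    have h1 : mu i + t ≠ 0 := by positivity
    exact_mod_cast h1
  have ns : ∀ z : ℂ, (Complex.normSq z : ℂ) = star z * z := fun z => by
    rw [Complex.normSq_eq_conj_mul_self]; rfl
  apply Complex.ofReal_injective
  push_cast
  simp only [ns]
  have e1 : ∀ i, ((lam i : ℂ) + t) * (star (V ψ i * ((lam i : ℂ) + t)⁻¹ - V y i) *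
      (V ψ i * ((lam i : ℂ) + t)⁻¹ - V y i)) =
      star (V ψ i) * V ψ i * ((lam i : ℂ) + t)⁻¹ - star (V ψ i) * V y i - star (V y i) * V ψ i
      + (lam i : ℂ) * (star (V y i) * V y i) + (t : ℂ) * (star (V y i) * V y i) := by
    intro i
    have hst : star (((lam i : ℂ) + t)⁻¹) = ((lam i : ℂ) + t)⁻¹ := by
      have : ((lam i : ℂ) + t)⁻¹ = (((lam i + t)⁻¹ : ℝ) : ℂ) := by push_cast; rfl
      rw [this]; exact Complex.conj_ofReal _
    rw [star_sub, star_mul', hst]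
    have := hl' i
    field_simp
    ring
  simp only [e1, Finset.sum_add_distrib, Finset.sum_sub_distrib, h1, h2, ← Finset.mul_sum]
  have e2 : ∑ j, star (ψ j) * ψ j * ((mu j : ℂ) + t)⁻¹ = ∑ j, star (ψ j) * y j := by
    refine Finset.sum_congr rfl fun j _ => ?_
    simp only [hy]; push_cast; ring
  have e3 : ∑ j, (mu j : ℂ) * (star (y j) * y j) + t * ∑ j, star (y j) * y j
      = ∑ j, star (y j) * ψ j := by
    rw [Finset.mul_sum, ← Finset.sum_add_distrib]
    refine Finset.sum_congr rfl fun j _ => ?_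
    have : ψ j = ((mu j : ℂ) + t) * y j := by
      have := hm' j
      simp only [hy]; push_cast; field_simp
    rw [this]; ring
  rw [e2]
  linear_combination -e3

lemma core {m n : Type*} [Fintype m] [Fintype n] (lam : n → ℝ) (mu : m → ℝ)
    (hl : ∀ i, 0 < lam i) (hm : ∀ j, 0 < mu j)
    (V : (m → ℂ) →ₗ[ℂ] (n → ℂ))
    (h1 : ∀ x y, ∑ i, star (V x i) * V y i = ∑ j, star (x j) * y j)
    (h2 : ∀ x, ∑ i, (lam i : ℂ) * (star (V x i) * V x i) = ∑ j, (mu j : ℂ) * (star (x j) * x j))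
    (ψ : m → ℂ)
    (hlog : ∑ i, Complex.normSq (V ψ i) * Real.log (lam i)
      = ∑ j, Complex.normSq (ψ j) * Real.log (mu j)) (i : n) :
    (Real.sqrt (lam i) : ℂ) * V ψ i = V (fun j => (Real.sqrt (mu j) : ℂ) * ψ j) i := by
  classical
  set G : ℝ → ℝ := fun t => ∑ i, Complex.normSq (V ψ i) * Real.log (lam i + t)
    - ∑ j, Complex.normSq (ψ j) * Real.log (mu j + t) with hG
  set g : ℝ → ℝ := fun t => ∑ i, Complex.normSq (V ψ i) * (lam i + t)⁻¹
    - ∑ j, Complex.normSq (ψ j) * (mu j + t)⁻¹ with hg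
  have hnorm : ∑ i, Complex.normSq (V ψ i) = ∑ j, Complex.normSq (ψ j) := by
    apply Complex.ofReal_injective
    push_cast
    simp only [Complex.normSq_eq_conj_mul_self]
    exact h1 ψ ψ
  have hderiv : ∀ t, 0 ≤ t → HasDerivAt G (g t) t := by
    intro t ht
    have aux : ∀ (c a : ℝ), 0 < a →
        HasDerivAt (fun t => c * Real.log (a + t)) (c * (a + t)⁻¹) t := by
      intro c a ha
      have h := ((hasDerivAt_id t).const_add a).log (by simp only [id]; positivity)
      simpa using h.const_mul c
    exact (HasDerivAt.fun_sum fun i _ => aux _ _ (hl i)).sub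
      (HasDerivAt.fun_sum fun j _ => aux _ _ (hm j))
  have hgnn : ∀ t, 0 < t → 0 ≤ g t := by
    intro t ht
    simp only [hg]
    rw [gap_identity lam mu hl hm V h1 h2 ψ t ht]
    exact Finset.sum_nonneg fun i _ =>
      mul_nonneg (by have := hl i; positivity) (Complex.normSq_nonneg _)
  have hmono : MonotoneOn G (Set.Ici 0) := by
    apply monotoneOn_of_deriv_nonneg (convex_Ici 0)
    · exact fun t ht => (hderiv t ht).continuousAt.continuousWithinAt
    · intro t ht
      rw [interior_Ici] at ht
      exact (hderiv t (le_of_lt ht)).differentiableAt.differentiableWithinAt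
    · intro t ht
      rw [interior_Ici] at ht
      rw [(hderiv t (le_of_lt ht)).deriv]
      exact hgnn t ht
  have hG0 : G 0 = 0 := by simp [hG, hlog]
  have hlim : Filter.Tendsto G Filter.atTop (nhds 0) := by
    have aux : ∀ (c a : ℝ), Filter.Tendsto (fun t => c * (Real.log (a + t) - Real.log t))
        Filter.atTop (nhds 0) := by
      intro c a
      have := (Real.tendsto_log_comp_add_sub_log a).const_mul c
      simpa [add_comm] using this
    have h := (tendsto_finsetSum Finset.univ
        (fun i _ => aux (Complex.normSq (V ψ i)) (lam i))).sub
      (tendsto_finsetSum Finset.univ (fun j _ => aux (Complex.normSq (ψ j)) (mu j)))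
    simp only [Finset.sum_const_zero, sub_zero] at h
    refine h.congr fun t => ?_
    simp only [hG, mul_sub, Finset.sum_sub_distrib, ← Finset.sum_mul, hnorm]
    ring
  have hGz : ∀ t, 0 ≤ t → G t = 0 := by
    intro t ht
    apply le_antisymm
    · refine ge_of_tendsto hlim ?_
      filter_upwards [Filter.eventually_ge_atTop t] with s hs
      exact hmono ht (ht.trans hs) hs
    · rw [← hG0]; exact hmono (Set.mem_Ici.2 le_rfl) ht ht
  have hgz : ∀ t, 0 < t → g t = 0 := by
    intro t ht
    have h := hderiv t ht.le
    have h' : HasDerivAt G 0 t := by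
      refine (hasDerivAt_const t (0 : ℝ)).congr_of_eventuallyEq ?_
      filter_upwards [lt_mem_nhds ht] with s hs
      exact hGz s hs.le
    exact h.unique h'
  have hres : ∀ t, 0 < t → ∀ i, V ψ i * ((lam i + t : ℝ) : ℂ)⁻¹
      - V (fun j => ψ j * ((mu j + t : ℝ) : ℂ)⁻¹) i = 0 := by
    intro t ht i
    have h := hgz t ht
    simp only [hg] at h
    rw [gap_identity lam mu hl hm V h1 h2 ψ t ht, Finset.sum_eq_zero_iff_of_nonneg] at h
    · have h3 := h i (Finset.mem_univ i)
      have : lam i + t ≠ 0 := by have := hl i; positivity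
      exact Complex.normSq_eq_zero.1 ((mul_eq_zero.1 h3).resolve_left this)
    · exact fun i _ => mul_nonneg (by have := hl i; positivity) (Complex.normSq_nonneg _)
  have hV : ∀ x : m → ℂ, V x i = ∑ j, x j * V (Pi.single j 1) i := by
    intro x
    rw [LinearMap.pi_apply_eq_sum_univ V x]
    simp only [Finset.sum_apply, Pi.smul_apply, smul_eq_mul]
    refine Finset.sum_congr rfl fun j _ => ?_
    have : (fun k => if j = k then (1 : ℂ) else 0) = Pi.single j 1 := by
      ext k
      simp [Pi.single_apply, eq_comm]
    rw [this]
  have hf := cauchy_fun (k := Option m) (fun o => o.elim (lam i) mu)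
    (by rintro (_ | j); exacts [hl i, hm j])
    (fun o => o.elim (- V ψ i) (fun j => ψ j * V (Pi.single j 1) i)) (by
      intro t ht
      have := hres t ht i
      rw [hV (fun j => ψ j * ((mu j + t : ℝ) : ℂ)⁻¹)] at this
      rw [Fintype.sum_option]
      simp only [Option.elim]
      have h4 : ∀ j, ψ j * V (Pi.single j 1) i * ((mu j + t : ℝ) : ℂ)⁻¹ =
        ψ j * ((mu j + t : ℝ) : ℂ)⁻¹ * V (Pi.single j 1) i := fun j => by ring
      simp only [h4]
      linear_combination -this) (fun x => (Real.sqrt x : ℂ))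
  rw [Fintype.sum_option] at hf
  simp only [Option.elim] at hf
  rw [hV (fun j => (Real.sqrt (mu j) : ℂ) * ψ j)]
  have h4 : ∀ j, ψ j * V (Pi.single j 1) i * (Real.sqrt (mu j) : ℂ) =
        (Real.sqrt (mu j) : ℂ) * ψ j * V (Pi.single j 1) i := fun j => by ring
  simp only [h4] at hf
  linear_combination -hf

/-- Matrix with prescribed real spectrum in a given basis. -/
noncomputable def specMat {n : Type*} [Fintype n] [DecidableEq n] (U : Matrix n n ℂ) (f : n → ℝ) :
    Matrix n n ℂ := U * Matrix.diagonal (fun i => (f i : ℂ)) * Uᴴ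

section spec
variable {n : Type*} [Fintype n] [DecidableEq n]

lemma specMat_mul {U : Matrix n n ℂ} (hU : Uᴴ * U = 1) (f g : n → ℝ) :
    specMat U f * specMat U g = specMat U (fun i => f i * g i) := by
  have : specMat U f * specMat U g = U * Matrix.diagonal (fun i => (f i : ℂ)) * (Uᴴ * U) *
      Matrix.diagonal (fun i => (g i : ℂ)) * Uᴴ := by
    simp only [specMat, Matrix.mul_assoc]
  rw [this, hU, Matrix.mul_one, Matrix.mul_assoc U, Matrix.diagonal_mul_diagonal]
  simp [specMat]

lemma specMat_one {U : Matrix n n ℂ} (hU : Uᴴ * U = 1) (f : n → ℝ) (hf : ∀ i, f i = 1) :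
    specMat U f = 1 := by
  have hU' : U * Uᴴ = 1 := mul_eq_one_comm.1 hU
  simp [specMat, hf, hU']

lemma specMat_conjTranspose (U : Matrix n n ℂ) (f : n → ℝ) : (specMat U f)ᴴ = specMat U f := by
  simp only [specMat, Matrix.conjTranspose_mul, Matrix.conjTranspose_conjTranspose,
    Matrix.diagonal_conjTranspose, Matrix.mul_assoc]
  congr 3
  ext i
  simp

end spec

lemma diag_sum {N : Type*} [Fintype N] [DecidableEq N] (a b : N → ℂ) (X Y : Matrix N N ℂ) :
    ∑ ij : N × N, a ij.1 * b ij.2 * (star (X ij.1 ij.2) * Y ij.1 ij.2)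
      = (Matrix.diagonal b * Xᴴ * Matrix.diagonal a * Y).trace := by
  rw [Fintype.sum_prod_type, Finset.sum_comm, Matrix.trace]
  refine Finset.sum_congr rfl fun j _ => ?_
  rw [Matrix.diag_apply, Matrix.mul_apply]
  refine Finset.sum_congr rfl fun i _ => ?_
  rw [Matrix.mul_diagonal, Matrix.diagonal_mul, Matrix.conjTranspose_apply]
  ring

lemma log_div_sum {L : Type*} [Fintype L] [DecidableEq L] (a b : L → ℝ) (ha : ∀ i, 0 < a i)
    (hb : ∀ i, 0 < b i) (X : Matrix L L ℂ) :
    ((∑ ij : L × L, Complex.normSq (X ij.1 ij.2) * Real.log (a ij.1 / b ij.2) : ℝ) : ℂ)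
    = (Matrix.diagonal (fun i => (Real.log (a i) : ℂ)) * (X * Xᴴ)).trace
      - (Matrix.diagonal (fun i => (Real.log (b i) : ℂ)) * (Xᴴ * X)).trace := by
  have ns : ∀ z : ℂ, (Complex.normSq z : ℂ) = star z * z := fun z => by
    rw [Complex.normSq_eq_conj_mul_self]; rfl
  have b1 := diag_sum (fun i => (Real.log (a i) : ℂ)) (fun _ => 1) X X
  have b2 := diag_sum (fun _ => 1) (fun i => (Real.log (b i) : ℂ)) X X
  simp only [Matrix.diagonal_one, Matrix.one_mul, Matrix.mul_one, one_mul, mul_one] at b1 b2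
  rw [Matrix.mul_assoc, Matrix.trace_mul_comm, Matrix.mul_assoc] at b1
  rw [Matrix.mul_assoc] at b2
  rw [← b1, ← b2, ← Finset.sum_sub_distrib]
  push_cast
  refine Finset.sum_congr rfl fun ij _ => ?_
  rw [ns, Real.log_div (ha _).ne' (hb _).ne']
  push_cast
  ring

lemma diag_log_trace {L : Type*} [Fintype L] [DecidableEq L] (a : L → ℝ) :
    (Matrix.diagonal (fun i => (Real.log (a i) : ℂ)) *
      Matrix.diagonal (fun i => (a i : ℂ))).trace = ∑ i, (a i : ℂ) * Real.log (a i) := by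
  rw [Matrix.diagonal_mul_diagonal, Matrix.trace_diagonal]
  exact Finset.sum_congr rfl fun i _ => mul_comm _ _

lemma abstract_petz {N M : Type*} [Fintype N] [Fintype M] [DecidableEq N] [DecidableEq M]
    (E : Matrix M M ℂ →ₗ[ℂ] Matrix N N ℂ)
    (Emul : ∀ X Y, E (X * Y) = E X * E Y) (Estar : ∀ X, E Xᴴ = (E X)ᴴ) (Eone : E 1 = 1)
    (ρ σ : Matrix N N ℂ) (τ ω : Matrix M M ℂ)
    (hτ : ∀ X, (ρ * E X).trace = (τ * X).trace) (hω : ∀ X, (σ * E X).trace = (ω * X).trace)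
    (U S : Matrix N N ℂ) (W Z : Matrix M M ℂ)
    (hU : Uᴴ * U = 1) (hS : Sᴴ * S = 1) (hW : Wᴴ * W = 1) (hZ : Zᴴ * Z = 1)
    (p s : N → ℝ) (w r : M → ℝ) (hp : ∀ i, 0 < p i) (hs : ∀ i, 0 < s i)
    (hw : ∀ i, 0 < w i) (hr : ∀ i, 0 < r i)
    (eρ : ρ = specMat U p) (eσ : σ = specMat S s) (eτ : τ = specMat W w) (eω : ω = specMat Z r)
    (hlog : (ρ * specMat S (fun i => Real.log (s i))).trace - ∑ i, (p i : ℂ) * Real.log (p i)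
      = (τ * specMat Z (fun i => Real.log (r i))).trace - ∑ i, (w i : ℂ) * Real.log (w i)) :
    specMat S (fun i => Real.sqrt (s i)) =
      E (specMat Z (fun i => Real.sqrt (r i)) * specMat W (fun i => (Real.sqrt (w i))⁻¹))
        * specMat U (fun i => Real.sqrt (p i)) := by
  have hU' : U * Uᴴ = 1 := mul_eq_one_comm.1 hU
  have hS' : S * Sᴴ = 1 := mul_eq_one_comm.1 hS
  have hW' : W * Wᴴ = 1 := mul_eq_one_comm.1 hW
  have hZ' : Z * Zᴴ = 1 := mul_eq_one_comm.1 hZ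
  have cs : ∀ x : ℝ, 0 < x → (Real.sqrt x : ℂ) * Real.sqrt x = x := fun x hx => by
    rw [← Complex.ofReal_mul, Real.mul_self_sqrt hx.le]
  have cn : ∀ x : ℝ, 0 < x → (Real.sqrt x : ℂ) ≠ 0 := fun x hx => by
    exact_mod_cast (Real.sqrt_pos.2 hx).ne'
  set dp : Matrix N N ℂ := Matrix.diagonal (fun i => (Real.sqrt (p i) : ℂ)) with hdp
  set dw : Matrix M M ℂ := Matrix.diagonal (fun i => ((Real.sqrt (w i))⁻¹ : ℂ)) with hdw
  set dw' : Matrix M M ℂ := Matrix.diagonal (fun i => (Real.sqrt (w i) : ℂ)) with hdw'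
  have dps : dpᴴ = dp := by
    rw [hdp, Matrix.diagonal_conjTranspose]; congr 1; ext i; simp
  have dws : dwᴴ = dw := by
    rw [hdw, Matrix.diagonal_conjTranspose]; congr 1; ext i; simp
  have dws' : dw'ᴴ = dw' := by
    rw [hdw', Matrix.diagonal_conjTranspose]; congr 1; ext i; simp
  have dpp : dp * dp = Matrix.diagonal (fun i => (p i : ℂ)) := by
    rw [hdp, Matrix.diagonal_mul_diagonal]; simp only [cs _ (hp _)]
  have dpi : dp * Matrix.diagonal (fun i => (p i : ℂ)⁻¹) * dp = 1 := by
    rw [hdp, Matrix.diagonal_mul_diagonal, Matrix.diagonal_mul_diagonal, ← Matrix.diagonal_one]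
    congr 1; ext i
    have := cn _ (hp i)
    rw [← cs _ (hp i)]; field_simp
  have dpi2 : dp * Matrix.diagonal (fun i => (Real.sqrt (p i) : ℂ)⁻¹) = 1 := by
    rw [hdp, Matrix.diagonal_mul_diagonal, ← Matrix.diagonal_one]
    congr 1; ext i
    have := cn _ (hp i)
    field_simp
  have dww : dw * dw = Matrix.diagonal (fun i => (w i : ℂ)⁻¹) := by
    rw [hdw, Matrix.diagonal_mul_diagonal]
    congr 1; ext i
    rw [← cs _ (hw i), mul_inv]
  have dww' : dw' * dw' = Matrix.diagonal (fun i => (w i : ℂ)) := by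
    rw [hdw', Matrix.diagonal_mul_diagonal]; simp only [cs _ (hw _)]
  have dw1 : dw' * dw = 1 := by
    rw [hdw, hdw', Matrix.diagonal_mul_diagonal, ← Matrix.diagonal_one]
    congr 1; ext i
    have := cn _ (hw i)
    field_simp
  have dwi : dw * Matrix.diagonal (fun i => (w i : ℂ)) * dw = 1 := by
    rw [← dww', ← Matrix.mul_assoc, mul_eq_one_comm.1 dw1, Matrix.one_mul, dw1]
  set K : Matrix M M ℂ := dw * Wᴴ with hK
  set Q : Matrix N N ℂ := U * dp with hQ
  have QQ : Q * Qᴴ = ρ := by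
    rw [hQ, Matrix.conjTranspose_mul, dps, eρ, specMat, ← dpp]; simp only [Matrix.mul_assoc]
  have QQ' : Qᴴ * Q = Matrix.diagonal (fun i => (p i : ℂ)) := by
    rw [hQ, Matrix.conjTranspose_mul, dps, Matrix.mul_assoc, ← Matrix.mul_assoc Uᴴ, hU,
      Matrix.one_mul, dpp]
  have QiQ : Q * Matrix.diagonal (fun i => (p i : ℂ)⁻¹) * Qᴴ = 1 := by
    have : Q * Matrix.diagonal (fun i => (p i : ℂ)⁻¹) * Qᴴ
      = U * (dp * Matrix.diagonal (fun i => (p i : ℂ)⁻¹) * dp) * Uᴴ := by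
      rw [hQ, Matrix.conjTranspose_mul, dps]; simp only [Matrix.mul_assoc]
    rw [this, dpi, Matrix.mul_one, hU']
  have KK : K * Kᴴ = Matrix.diagonal (fun i => (w i : ℂ)⁻¹) := by
    rw [hK, Matrix.conjTranspose_mul, Matrix.conjTranspose_conjTranspose, dws, Matrix.mul_assoc,
      ← Matrix.mul_assoc Wᴴ, hW, Matrix.one_mul, dww]
  have KtK : K * τ * Kᴴ = 1 := by
    have : K * τ * Kᴴ = dw * (Wᴴ * W) * Matrix.diagonal (fun i => (w i : ℂ)) * (Wᴴ * W) * dw := by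
      rw [hK, Matrix.conjTranspose_mul, Matrix.conjTranspose_conjTranspose, dws, eτ, specMat]
      simp only [Matrix.mul_assoc]
    rw [this, hW, Matrix.mul_one, Matrix.mul_one, dwi]
  let mk : (M × M → ℂ) → Matrix M M ℂ := fun x => Matrix.of fun i j => x (i, j)
  let F : Matrix M M ℂ → Matrix N N ℂ := fun X => Sᴴ * E (Z * X * K) * Q
  let V : (M × M → ℂ) →ₗ[ℂ] (N × N → ℂ) :=
    { toFun := fun x ij => F (mk x) ij.1 ij.2
      map_add' := by
        intro x y
        ext ij
        have : mk (x + y) = mk x + mk y := by ext i j; rfl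
        simp only [F, this, Matrix.mul_add, Matrix.add_mul, map_add, Matrix.add_apply, Pi.add_apply]
      map_smul' := by
        intro c x
        ext ij
        have : mk (c • x) = c • mk x := by ext i j; rfl
        simp only [F, this, Matrix.mul_smul, Matrix.smul_mul, map_smul, Matrix.smul_apply,
          Pi.smul_apply, RingHom.id_apply] }
  have hV : ∀ x ij, V x ij = F (mk x) ij.1 ij.2 := fun _ _ => rfl
  have hF1 : ∀ X Y, ((F X)ᴴ * F Y).trace = (Xᴴ * Y).trace := by
    intro X Y
    have e1 : (F X)ᴴ * F Y = Qᴴ * (E (Kᴴ * Xᴴ * Zᴴ) * (S * Sᴴ) * E (Z * Y * K) * Q) := by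
      simp only [F, Matrix.conjTranspose_mul, Matrix.conjTranspose_conjTranspose, ← Estar,
        Matrix.mul_assoc]
    rw [e1, hS', Matrix.mul_one, Matrix.trace_mul_comm, Matrix.mul_assoc, QQ, ← Emul,
      Matrix.trace_mul_comm, hτ]
    have e2 : τ * (Kᴴ * Xᴴ * Zᴴ * (Z * Y * K)) = (τ * Kᴴ * Xᴴ * (Zᴴ * Z) * Y) * K := by
      simp only [Matrix.mul_assoc]
    rw [e2, hZ, Matrix.mul_one, Matrix.trace_mul_comm]
    have e3 : K * (τ * Kᴴ * Xᴴ * Y) = K * τ * Kᴴ * (Xᴴ * Y) := by simp only [Matrix.mul_assoc]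
    rw [e3, KtK, Matrix.one_mul]
  have hF2 : ∀ X, (Matrix.diagonal (fun i => (p i : ℂ)⁻¹) * (F X)ᴴ *
      Matrix.diagonal (fun i => (s i : ℂ)) * F X).trace =
      (Matrix.diagonal (fun i => (w i : ℂ)⁻¹) * Xᴴ * Matrix.diagonal (fun i => (r i : ℂ))
        * X).trace := by
    intro X
    have e1 : Matrix.diagonal (fun i => (p i : ℂ)⁻¹) * (F X)ᴴ *
      Matrix.diagonal (fun i => (s i : ℂ)) * F X =
      (Matrix.diagonal (fun i => (p i : ℂ)⁻¹) * Qᴴ * E (Z * X * K)ᴴ * σ * E (Z * X * K)) * Q := by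
      simp only [F, Matrix.conjTranspose_mul, Matrix.conjTranspose_conjTranspose, ← Estar,
        Matrix.mul_assoc, eσ, specMat]
    have e2 : Q * (Matrix.diagonal (fun i => (p i : ℂ)⁻¹) * Qᴴ * E (Z * X * K)ᴴ * σ
        * E (Z * X * K)) = (Q * Matrix.diagonal (fun i => (p i : ℂ)⁻¹) * Qᴴ) * E (Z * X * K)ᴴ *
          (σ * E (Z * X * K)) := by simp only [Matrix.mul_assoc]
    rw [e1, Matrix.trace_mul_comm, e2, QiQ, Matrix.one_mul, Matrix.trace_mul_comm,
      Matrix.mul_assoc, ← Emul, hω]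
    have e3 : ω * (Z * X * K * (Z * X * K)ᴴ) =
        Z * (Matrix.diagonal (fun i => (r i : ℂ)) * (Zᴴ * Z) * X * (K * Kᴴ) * Xᴴ * Zᴴ) := by
      simp only [Matrix.conjTranspose_mul, Matrix.mul_assoc, eω, specMat]
    rw [e3, Matrix.trace_mul_comm, Matrix.mul_assoc, hZ, KK, Matrix.mul_one, Matrix.mul_one]
    rw [Matrix.mul_assoc (Matrix.diagonal _ * X), Matrix.trace_mul_comm]
    simp only [Matrix.mul_assoc]
  let Ψ : Matrix M M ℂ := Zᴴ * W * dw'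
  have hFΨ : F Ψ = Sᴴ * Q := by
    have : Z * Ψ * K = (Z * Zᴴ) * W * (dw' * dw) * Wᴴ := by
      simp only [Ψ, hK, Matrix.mul_assoc]
    simp only [F]
    rw [this, hZ', dw1, Matrix.mul_one, Matrix.one_mul, hW', Eone, Matrix.mul_one]
  have ns : ∀ z : ℂ, (Complex.normSq z : ℂ) = star z * z := fun z => by
    rw [Complex.normSq_eq_conj_mul_self]; rfl
  have hmain := core (fun ij : N × N => s ij.1 / p ij.2) (fun ij : M × M => r ij.1 / w ij.2)
    (fun ij => div_pos (hs _) (hp _)) (fun ij => div_pos (hr _) (hw _)) V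
    (by
      intro x y
      have a1 := diag_sum (fun _ => 1) (fun _ => 1) (F (mk x)) (F (mk y))
      have a2 := diag_sum (fun _ => 1) (fun _ => 1) (mk x) (mk y)
      simp only [Matrix.diagonal_one, Matrix.one_mul, Matrix.mul_one, one_mul] at a1 a2
      have a3 := hF1 (mk x) (mk y)
      rw [← a1, ← a2] at a3
      exact a3)
    (by
      intro x
      have a1 := diag_sum (fun i => (s i : ℂ)) (fun i => (p i : ℂ)⁻¹) (F (mk x)) (F (mk x))
      have a2 := diag_sum (fun i => (r i : ℂ)) (fun i => (w i : ℂ)⁻¹) (mk x) (mk x)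
      have a3 := hF2 (mk x)
      rw [← a1, ← a2] at a3
      simp only [hV, Complex.ofReal_div, div_eq_mul_inv (_ : ℂ)]
      exact a3)
    (fun ij => Ψ ij.1 ij.2)
    (by
      have hmk : mk (fun ij => Ψ ij.1 ij.2) = Ψ := rfl
      apply Complex.ofReal_injective
      simp only [hV, hmk, hFΨ]
      have g1 := log_div_sum s p hs hp (Sᴴ * Q)
      have g2 := log_div_sum r w hr hw Ψ
      rw [g1, g2]
      have x1 : (Sᴴ * Q) * (Sᴴ * Q)ᴴ = Sᴴ * ρ * S := by
        rw [← QQ]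
        simp only [Matrix.conjTranspose_mul, Matrix.conjTranspose_conjTranspose, Matrix.mul_assoc]
      have x2 : (Sᴴ * Q)ᴴ * (Sᴴ * Q) = Matrix.diagonal (fun i => (p i : ℂ)) := by
        rw [Matrix.conjTranspose_mul, Matrix.conjTranspose_conjTranspose, Matrix.mul_assoc,
          ← Matrix.mul_assoc S, hS', Matrix.one_mul, QQ']
      have x3 : Ψ * Ψᴴ = Zᴴ * τ * Z := by
        rw [eτ, specMat, ← dww']
        simp only [Ψ, Matrix.conjTranspose_mul, Matrix.conjTranspose_conjTranspose,
          Matrix.mul_assoc, dws']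
      have x4 : Ψᴴ * Ψ = Matrix.diagonal (fun i => (w i : ℂ)) := by
        have : Ψᴴ * Ψ = dw' * (Wᴴ * (Z * Zᴴ) * W) * dw' := by
          simp only [Ψ, Matrix.conjTranspose_mul, Matrix.conjTranspose_conjTranspose,
            Matrix.mul_assoc, dws']
        rw [this, hZ', Matrix.mul_one, hW, Matrix.mul_one, dww']
      rw [x1, x2, x3, x4, diag_log_trace, diag_log_trace]
      have y1 : (Matrix.diagonal (fun i => (Real.log (s i) : ℂ)) * (Sᴴ * ρ * S)).trace
          = (ρ * specMat S (fun i => Real.log (s i))).trace := by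
        rw [Matrix.mul_assoc Sᴴ, ← Matrix.mul_assoc, Matrix.trace_mul_comm]
        simp only [specMat, Matrix.mul_assoc]
      have y2 : (Matrix.diagonal (fun i => (Real.log (r i) : ℂ)) * (Zᴴ * τ * Z)).trace
          = (τ * specMat Z (fun i => Real.log (r i))).trace := by
        rw [Matrix.mul_assoc Zᴴ, ← Matrix.mul_assoc, Matrix.trace_mul_comm]
        simp only [specMat, Matrix.mul_assoc]
      rw [y1, y2, hlog])
  have hmat : Matrix.diagonal (fun i => (Real.sqrt (s i) : ℂ)) * (Sᴴ * Q) *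
      Matrix.diagonal (fun i => (Real.sqrt (p i) : ℂ)⁻¹)
      = F (Matrix.diagonal (fun i => (Real.sqrt (r i) : ℂ)) * Ψ * dw) := by
    ext i j
    have h := hmain (i, j)
    rw [hV, hV] at h
    have hmk : mk (fun ij => Ψ ij.1 ij.2) = Ψ := rfl
    have hmk2 : mk (fun ij => ((Real.sqrt (r ij.1 / w ij.2) : ℝ) : ℂ) * Ψ ij.1 ij.2)
        = Matrix.diagonal (fun i => (Real.sqrt (r i) : ℂ)) * Ψ * dw := by
      ext a b
      rw [hdw, Matrix.mul_diagonal, Matrix.diagonal_mul]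
      show ((Real.sqrt (r a / w b) : ℝ) : ℂ) * Ψ a b = _
      rw [Real.sqrt_div (hr a).le]
      push_cast
      ring
    rw [hmk, hmk2, hFΨ] at h
    rw [← h, Matrix.mul_diagonal, Matrix.diagonal_mul]
    show _ = ((Real.sqrt (s i / p j) : ℝ) : ℂ) * _
    rw [Real.sqrt_div (hs i).le]
    push_cast
    ring
  have hfin := congrArg (fun X => S * X * Uᴴ) hmat
  have l1 : S * (Matrix.diagonal (fun i => (Real.sqrt (s i) : ℂ)) * (Sᴴ * Q) *
      Matrix.diagonal (fun i => (Real.sqrt (p i) : ℂ)⁻¹)) * Uᴴ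
      = specMat S (fun i => Real.sqrt (s i)) * (U * (dp *
        Matrix.diagonal (fun i => (Real.sqrt (p i) : ℂ)⁻¹)) * Uᴴ) := by
    simp only [specMat, hQ, Matrix.mul_assoc]
  have l2 : Z * (Matrix.diagonal (fun i => (Real.sqrt (r i) : ℂ)) * Ψ * dw) * K
      = specMat Z (fun i => Real.sqrt (r i)) * specMat W (fun i => (Real.sqrt (w i))⁻¹) := by
    have : Z * (Matrix.diagonal (fun i => (Real.sqrt (r i) : ℂ)) * Ψ * dw) * K
      = Z * Matrix.diagonal (fun i => (Real.sqrt (r i) : ℂ)) * Zᴴ * (W * (dw' * dw) * dw * Wᴴ) := by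
      simp only [Ψ, hK, Matrix.mul_assoc]
    rw [this, dw1, Matrix.mul_one]
    simp only [specMat, hdw, Complex.ofReal_inv]
  beta_reduce at hfin
  rw [l1, dpi2, Matrix.mul_one, hU', Matrix.mul_one] at hfin
  rw [hfin]
  simp only [F]
  rw [l2, Matrix.mul_assoc Sᴴ, ← Matrix.mul_assoc S, hS', Matrix.one_mul, Matrix.mul_assoc]
  simp only [specMat, hQ, hdp]

section tripartite

/-- `id_X ⊗ M`. -/
noncomputable def exR {X Y : Type*} [DecidableEq X] (M : Matrix Y Y ℂ) :
    Matrix (X × Y) (X × Y) ℂ :=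
  fun x y => (if x.1 = y.1 then 1 else 0) * M x.2 y.2

section
variable {X Y : Type*} [Fintype X] [Fintype Y] [DecidableEq X] [DecidableEq Y]

lemma exR_mul (M N : Matrix Y Y ℂ) : (exR (M * N) : Matrix (X × Y) (X × Y) ℂ) = exR M * exR N := by
  ext x y
  simp only [exR, Matrix.mul_apply, Fintype.sum_prod_type]
  rw [Finset.sum_eq_single x.1]
  · simp only [if_true, one_mul, Finset.mul_sum]
    exact Finset.sum_congr rfl fun i _ => by ring
  · intro b _ hb
    simp [hb.symm]
  · simp

lemma exR_diagonal (d : Y → ℂ) :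
    (exR (Matrix.diagonal d) : Matrix (X × Y) (X × Y) ℂ) = Matrix.diagonal (fun x => d x.2) := by
  ext x y
  by_cases h1 : x.1 = y.1 <;> by_cases h2 : x.2 = y.2 <;>
    simp [exR, Matrix.diagonal_apply, Prod.ext_iff, h1, h2]

lemma exR_conjTranspose (M : Matrix Y Y ℂ) :
    (exR Mᴴ : Matrix (X × Y) (X × Y) ℂ) = (exR M)ᴴ := by
  ext x y
  simp only [exR, Matrix.conjTranspose_apply, eq_comm (a := x.1)]
  split_ifs <;> simp

lemma exR_one : (exR 1 : Matrix (X × Y) (X × Y) ℂ) = 1 := by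
  rw [← Matrix.diagonal_one, exR_diagonal, Matrix.diagonal_one]

lemma exR_spec (U : Matrix Y Y ℂ) (f : Y → ℝ) :
    (exR (specMat U f) : Matrix (X × Y) (X × Y) ℂ) = specMat (exR U) (fun x => f x.2) := by
  simp only [specMat, exR_mul, exR_diagonal, exR_conjTranspose]

lemma trace_exR (ρ : Matrix (X × Y) (X × Y) ℂ) (M : Matrix Y Y ℂ) :
    (ρ * exR M).trace = (bptFst ρ * M).trace := by
  simp only [Matrix.trace, Matrix.diag_apply, Matrix.mul_apply, exR, bptFst, Fintype.sum_prod_type,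
    Finset.sum_mul]
  rw [Finset.sum_comm]
  refine Finset.sum_congr rfl fun y _ => ?_
  rw [Finset.sum_comm]
  refine Eq.trans ?_ (Finset.sum_comm.trans (Finset.sum_comm.trans Finset.sum_comm))
  rw [Finset.sum_comm]
  refine Finset.sum_congr rfl fun x _ => ?_
  rw [Finset.sum_comm]
  refine Finset.sum_congr rfl fun z _ => ?_
  rw [Finset.sum_eq_single x]
  · simp
  · intro b _ hb; simp [hb]
  · simp

lemma bptFst_posDef [Nonempty X] {ρ : Matrix (X × Y) (X × Y) ℂ} (h : ρ.PosDef) :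
    (bptFst ρ).PosDef := by
  have : bptFst ρ = ∑ x : X, ρ.submatrix (fun y => (x, y)) (fun y => (x, y)) := by
    ext i j
    simp [bptFst, Matrix.sum_apply]
  rw [this]
  exact Matrix.posDef_sum Finset.univ_nonempty
    fun x _ => h.submatrix (fun a b hab => (Prod.ext_iff.1 hab).2)
end

variable {A B C : Type*} [Fintype A] [Fintype B] [Fintype C]
  [DecidableEq A] [DecidableEq B] [DecidableEq C]

lemma ptC_posDef [Nonempty C] {ρ : Matrix (A × B × C) (A × B × C) ℂ} (h : ρ.PosDef) :
    (ptC ρ).PosDef := by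
  have : ptC ρ = ∑ c : C, ρ.submatrix (fun y => (y.1, y.2, c)) (fun y => (y.1, y.2, c)) := by
    ext i j
    simp [ptC, Matrix.sum_apply]
  rw [this]
  refine Matrix.posDef_sum Finset.univ_nonempty
    fun x _ => h.submatrix (fun a b hab => ?_)
  simp only [Prod.mk.injEq] at hab
  exact Prod.ext hab.1 hab.2.1

lemma extAB_mul (M N : Matrix (A × B) (A × B) ℂ) :
    (extAB (M * N) : Matrix (A × B × C) (A × B × C) ℂ) = extAB M * extAB N := by
  ext x y
  simp only [extAB, Matrix.mul_apply, Fintype.sum_prod_type, Finset.sum_mul]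
  refine Finset.sum_congr rfl fun a _ => Finset.sum_congr rfl fun b _ => ?_
  rw [Finset.sum_eq_single x.2.2]
  · simp only [if_true, mul_one]; ring
  · intro c _ hc
    simp [hc.symm]
  · simp

lemma extAB_conjTranspose (M : Matrix (A × B) (A × B) ℂ) :
    (extAB Mᴴ : Matrix (A × B × C) (A × B × C) ℂ) = (extAB M)ᴴ := by
  ext x y
  simp only [extAB, Matrix.conjTranspose_apply, eq_comm (a := x.2.2)]
  split_ifs <;> simp

lemma extAB_one : (extAB 1 : Matrix (A × B × C) (A × B × C) ℂ) = 1 := by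
  ext ⟨a, b, c⟩ ⟨a', b', c'⟩
  by_cases h1 : a = a' <;> by_cases h2 : b = b' <;> by_cases h3 : c = c' <;>
    simp [extAB, Matrix.one_apply, h1, h2, h3]

lemma trace_extAB (ρ : Matrix (A × B × C) (A × B × C) ℂ) (M : Matrix (A × B) (A × B) ℂ) :
    (ρ * extAB M).trace = (ptC ρ * M).trace := by
  simp only [Matrix.trace, Matrix.diag_apply, Matrix.mul_apply, extAB, ptC, Fintype.sum_prod_type,
    Finset.sum_mul]
  refine Finset.sum_congr rfl fun a _ => Finset.sum_congr rfl fun b _ => ?_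
  rw [Finset.sum_comm]
  refine Finset.sum_congr rfl fun a' _ => ?_
  rw [Finset.sum_comm]
  refine Finset.sum_congr rfl fun b' _ => Finset.sum_congr rfl fun c _ => ?_
  rw [Finset.sum_eq_single c]
  · simp
  · intro d _ hd; simp [hd]
  · simp

lemma extAB_exR (M : Matrix B B ℂ) :
    (extAB (exR M) : Matrix (A × B × C) (A × B × C) ℂ) = extB M := rfl

lemma ptAC_eq (ρ : Matrix (A × B × C) (A × B × C) ℂ) : ptAC ρ = bptFst (ptC ρ) := rfl

lemma ptC_exR (Q : Matrix (B × C) (B × C) ℂ) :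
    ptC (exR Q : Matrix (A × B × C) (A × B × C) ℂ) = exR (bptSnd Q) := by
  ext x y
  simp only [ptC, exR, bptSnd, Finset.mul_sum]

lemma marg_eq (ρ : Matrix (A × B × C) (A × B × C) ℂ) : bptFst (ptC ρ) = bptSnd (ptA ρ) := by
  ext b b'
  simp only [bptFst, ptC, bptSnd, ptA]
  exact Finset.sum_comm

lemma eig_unitary {n : Type*} [Fintype n] [DecidableEq n] {M : Matrix n n ℂ}
    (h : M.IsHermitian) :
    (h.eigenvectorUnitary : Matrix n n ℂ)ᴴ * (h.eigenvectorUnitary : Matrix n n ℂ) = 1 :=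
  Unitary.coe_star_mul_self h.eigenvectorUnitary

lemma eig_spec {n : Type*} [Fintype n] [DecidableEq n] {M : Matrix n n ℂ}
    (h : M.IsHermitian) :
    M = specMat (h.eigenvectorUnitary : Matrix n n ℂ) h.eigenvalues := by
  conv_lhs => rw [h.spectral_theorem, Unitary.conjStarAlgAut_apply]
  rfl

lemma matFun_spec {n : Type*} [Fintype n] [DecidableEq n] {M : Matrix n n ℂ}
    (h : M.IsHermitian) (f : ℝ → ℝ) :
    matFun f M = specMat (h.eigenvectorUnitary : Matrix n n ℂ) (fun i => f (h.eigenvalues i)) := by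
  rw [matFun, dif_pos h]; rfl

lemma trace_log {n : Type*} [Fintype n] [DecidableEq n] {M : Matrix n n ℂ}
    (h : M.IsHermitian) :
    (M * specMat (h.eigenvectorUnitary : Matrix n n ℂ)
      (fun i => Real.log (h.eigenvalues i))).trace = ((-vnEntropy M : ℝ) : ℂ) := by
  rw [vnEntropy, dif_pos h, neg_neg]
  conv_lhs => rw [congrArg (fun X => X * _) (eig_spec h)]
  beta_reduce
  rw [specMat_mul (eig_unitary h), specMat, Matrix.mul_assoc, Matrix.trace_mul_comm,
    Matrix.mul_assoc, eig_unitary h, Matrix.mul_one, Matrix.trace_diagonal]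
  push_cast
  rfl

lemma sum_log {n : Type*} [Fintype n] [DecidableEq n] {M : Matrix n n ℂ}
    (h : M.IsHermitian) :
    ∑ i, (h.eigenvalues i : ℂ) * Real.log (h.eigenvalues i) = ((-vnEntropy M : ℝ) : ℂ) := by
  rw [vnEntropy, dif_pos h, neg_neg]
  push_cast
  rfl

lemma invSqrt_mul_sqrt {n : Type*} [Fintype n] [DecidableEq n] (M : Matrix n n ℂ)
    (hM : M.PosDef) : matInvSqrt M * matSqrt M = 1 := by
  rw [matInvSqrt, matSqrt, matFun_spec hM.isHermitian, matFun_spec hM.isHermitian,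
    specMat_mul (eig_unitary _)]
  exact specMat_one (eig_unitary _) _
    (fun i => inv_mul_cancel₀ (Real.sqrt_pos.2 (hM.eigenvalues_pos i)).ne')

lemma sqrt_factor (ρ : Matrix (A × B × C) (A × B × C) ℂ) (hρ : ρ.PosDef)
    (hA : Nonempty A) (hC : Nonempty C) (hqmc : qcmi ρ = 0) :
    extAB (matSqrt (ptC ρ)) * extB (matInvSqrt (ptAC ρ)) * extBC (matSqrt (ptA ρ)) =
      matSqrt ρ := by
  have pAB : (ptC ρ).PosDef := ptC_posDef hρ
  have pBC : (ptA ρ).PosDef := bptFst_posDef hρ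
  have pB : (ptAC ρ).PosDef := bptFst_posDef pAB
  have h0 := hρ.isHermitian
  have h1 := pAB.isHermitian
  have h2 := pBC.isHermitian
  have h3 := pB.isHermitian
  have eBC : ∀ M : Matrix (B × C) (B × C) ℂ,
    (extBC M : Matrix (A × B × C) (A × B × C) ℂ) = exR M := fun _ => rfl
  let E : Matrix (A × B) (A × B) ℂ →ₗ[ℂ] Matrix (A × B × C) (A × B × C) ℂ :=
    { toFun := extAB
      map_add' := fun X Y => by ext x y; simp only [extAB, Matrix.add_apply, add_mul]
      map_smul' := fun c X => by ext x y; simp [extAB, mul_assoc] }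
  have key := abstract_petz E extAB_mul extAB_conjTranspose extAB_one ρ (exR (ptA ρ)) (ptC ρ)
    (exR (ptAC ρ)) (trace_extAB ρ) (fun X => by
      show (exR (ptA ρ) * extAB X).trace = _
      rw [trace_extAB, ptC_exR, ← marg_eq, ptAC_eq])
    h0.eigenvectorUnitary (exR h2.eigenvectorUnitary) h1.eigenvectorUnitary
    (exR h3.eigenvectorUnitary) (eig_unitary h0)
    (by rw [← exR_conjTranspose, ← exR_mul, eig_unitary, exR_one]) (eig_unitary h1)
    (by rw [← exR_conjTranspose, ← exR_mul, eig_unitary, exR_one])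
    h0.eigenvalues (fun x => h2.eigenvalues x.2) h1.eigenvalues (fun x => h3.eigenvalues x.2)
    hρ.eigenvalues_pos (fun x => pBC.eigenvalues_pos x.2) pAB.eigenvalues_pos
    (fun x => pB.eigenvalues_pos x.2) (eig_spec h0)
    (by rw [← exR_spec, ← eig_spec]) (eig_spec h1) (by rw [← exR_spec, ← eig_spec])
    (by
      rw [← exR_spec _ (fun x => Real.log (h2.eigenvalues x)),
        ← exR_spec _ (fun x => Real.log (h3.eigenvalues x)), trace_exR, trace_exR, sum_log,
        sum_log]
      have t2 := trace_log h2
      have t3 := trace_log h3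
      have t2' : (bptFst ρ * specMat (h2.eigenvectorUnitary : Matrix (B × C) (B × C) ℂ)
        (fun i => Real.log (h2.eigenvalues i))).trace = ((-vnEntropy (ptA ρ) : ℝ) : ℂ) := t2
      have t3' : (bptFst (ptC ρ) * specMat (h3.eigenvectorUnitary : Matrix B B ℂ)
        (fun i => Real.log (h3.eigenvalues i))).trace = ((-vnEntropy (ptAC ρ) : ℝ) : ℂ) := t3
      rw [t2', t3', ← Complex.ofReal_sub, ← Complex.ofReal_sub]
      congr 1
      simp only [qcmi] at hqmc
      linarith)
  rw [← exR_spec _ (fun x => Real.sqrt (h2.eigenvalues x)),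
        ← exR_spec _ (fun x => Real.sqrt (h3.eigenvalues x)), ← matFun_spec h2 Real.sqrt,
        ← matFun_spec h3 Real.sqrt, ← matFun_spec h1 (fun x => (Real.sqrt x)⁻¹),
        ← matFun_spec h0 Real.sqrt] at key
  have key' : extBC (matSqrt (ptA ρ)) =
      extAB (exR (matSqrt (ptAC ρ)) * matInvSqrt (ptC ρ)) * matSqrt ρ := key
  rw [key', ← extAB_exR, ← Matrix.mul_assoc, ← extAB_mul, ← extAB_mul]
  have : matSqrt (ptC ρ) * exR (matInvSqrt (ptAC ρ)) *
      (exR (matSqrt (ptAC ρ)) * matInvSqrt (ptC ρ)) = 1 := by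
    rw [Matrix.mul_assoc, ← Matrix.mul_assoc (exR _), ← exR_mul, invSqrt_mul_sqrt _ pB, exR_one, Matrix.one_mul]
    have := invSqrt_mul_sqrt _ pAB
    exact mul_eq_one_comm.1 this
  rw [this, extAB_one, Matrix.one_mul]

lemma matFun_conjTranspose {n : Type*} [Fintype n] [DecidableEq n] (f : ℝ → ℝ)
    (M : Matrix n n ℂ) : (matFun f M)ᴴ = matFun f M := by
  by_cases h : M.IsHermitian
  · rw [matFun_spec h, specMat_conjTranspose]
  · rw [matFun, dif_neg h, Matrix.conjTranspose_zero]

end tripartite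

/-- Necessity: for an invertible quantum Markov chain `ρ_ABC`
(`I(A:C|B) = 0`), the marginals agree on `B` (`Tr_A ρ_AB = Tr_C ρ_BC`) and the operator
`Θ_ABC = ρ_BC^{1/2} ρ_B^{-1/2} ρ_AB^{1/2}` is Hermitian, in particular normal. -/
theorem qmc_compat_necessary {A B C : Type*} [Fintype A] [Fintype B] [Fintype C]
    [DecidableEq A] [DecidableEq B] [DecidableEq C]
    (ρ : Matrix (A × B × C) (A × B × C) ℂ) (hρ : IsDensity ρ) (hρinv : IsUnit ρ)
    (hqmc : qcmi ρ = 0) :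
    bptFst (ptC ρ) = bptSnd (ptA ρ) ∧
    ∀ Θ : Matrix (A × B × C) (A × B × C) ℂ,
      Θ = extBC (matSqrt (ptA ρ)) * extB (matInvSqrt (ptAC ρ)) * extAB (matSqrt (ptC ρ)) →
      Θ.IsHermitian ∧ Θ * Θᴴ = Θᴴ * Θ := by
  have hpd : ρ.PosDef := hρ.1.posDef_iff_isUnit.2 hρinv
  have hne : Nonempty (A × B × C) := by
    by_contra hcon
    rw [not_nonempty_iff] at hcon
    have h := hρ.2
    simp [Matrix.trace] at h
  obtain ⟨a, b, c⟩ := hne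
  refine ⟨marg_eq ρ, ?_⟩
  rintro Θ rfl
  have hf := sqrt_factor ρ hpd ⟨a⟩ ⟨c⟩ hqmc
  have hT : extBC (matSqrt (ptA ρ)) * extB (matInvSqrt (ptAC ρ)) * extAB (matSqrt (ptC ρ))
      = matSqrt ρ := by
    have h := congrArg Matrix.conjTranspose hf
    have eBC : ∀ M : Matrix (B × C) (B × C) ℂ,
      (extBC M : Matrix (A × B × C) (A × B × C) ℂ) = exR M := fun _ => rfl
    simp only [matSqrt, matInvSqrt] at h ⊢
    rw [Matrix.conjTranspose_mul, Matrix.conjTranspose_mul, matFun_conjTranspose,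
      ← extAB_conjTranspose, matFun_conjTranspose, ← extAB_exR, ← extAB_conjTranspose,
      ← exR_conjTranspose, matFun_conjTranspose, eBC, ← exR_conjTranspose, matFun_conjTranspose,
      ← Matrix.mul_assoc] at h
    exact h
  rw [hT]
  have hH : (matSqrt ρ)ᴴ = matSqrt ρ := matFun_conjTranspose _ _
  exact ⟨hH, by rw [hH]⟩
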